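/- arXiv:1206.0633 — 2 statements merged into one kernel-verified Lean document; each statement's English description precedes it below -/
import Mathlib

section
/- For all integers w ≥ 1 and 2 ≤ d ≤ 2w, x_{d,w} = (1/c_w)·Σ_{k=1}^{w} S_{w−1}(w−k)·C(w−k, d−2k)·α₁^{w−d+k}·α₂^{d−2k}·β^{k−1}, where a summand is interpreted as 0 whenever d−2k < 0 or d−2k > w−k (i.e. whenever the binomial coefficient C(w−k, d−2k) vanishes). -/
open Finset

namespace Finset

/-- Expansion of `∏ (f i * a + b)` in terms of the elementary symmetric functions of `f`. -/
theorem prod_mul_add_eq_sum_powersetCard {ι R : Type*} [CommSemiring R]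
    (s : Finset ι) (f : ι → R) (a b : R) :
    ∏ i ∈ s, (f i * a + b) =
      ∑ k ∈ range (#s + 1), (∑ t ∈ powersetCard k s, ∏ i ∈ t, f i) * (a ^ k * b ^ (#s - k)) := by
  classical
  rw [prod_add, sum_powerset]
  refine sum_congr rfl fun k _ => ?_
  rw [sum_mul]
  refine sum_congr rfl fun t ht => ?_
  obtain ⟨hts, rfl⟩ := mem_powersetCard.1 ht
  rw [prod_mul_distrib, prod_const, prod_const, card_sdiff_of_subset hts, mul_assoc]

end Finset

namespace Polynomial

theorem coeff_C_add_C_mul_X_pow {R : Type*} [CommSemiring R] (a b : R) (n k : ℕ) :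
    ((C a + C b * X) ^ n).coeff k = a ^ (n - k) * b ^ k * (n.choose k : R) := by
  have h : (C a + C b * X) ^ n = ((X + C a) ^ n).comp (C b * X) := by
    simp [add_comm]
  rw [h, comp_C_mul_X_coeff, coeff_X_add_C_pow]
  ring

/-- Up to the factor `c w`, the solution of the recurrence is given by the coefficients of an
explicit product of quadratic polynomials. -/
theorem coeff_prod_eq_of_recurrence (α₁ α₂ β : ℝ) (γ : ℕ → ℝ) (hγ : ∀ w, γ w ≠ 0)
    (x : ℤ → ℕ → ℝ)
    (hbase : x 2 1 = 1 / γ 1)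
    (hbase' : ∀ d : ℤ, d ≠ 2 → x d 1 = 0)
    (hrec : ∀ (d : ℤ) (w : ℕ), 2 ≤ w →
      x d w = (1 / γ w) *
        (α₁ * (w - 1) * x d (w - 1) + α₂ * (w - 1) * x (d - 1) (w - 1)
          + β * x (d - 2) (w - 1))) (w : ℕ) :
    (∀ d < 2, x d (w + 1) = 0) ∧
      ∀ n : ℕ, (∏ j ∈ Icc 1 (w + 1), γ j) * x (n + 2) (w + 1) =
        (∏ j ∈ Icc 1 w, (C (j : ℝ) * (C α₁ + C α₂ * X) + C β * X ^ 2)).coeff n := by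
  induction w with
  | zero =>
    refine ⟨fun d hd => hbase' d hd.ne, fun n => ?_⟩
    rcases n with _ | n
    · simp [hbase, hγ]
    · rw [hbase' _ (by push_cast; omega)]
      simp [coeff_one]
  | succ w ih =>
    obtain ⟨ih0, ih⟩ := ih
    have hstep (d : ℤ) := hrec d (w + 1 + 1) (by omega)
    simp only [Nat.add_sub_cancel, Nat.cast_add_one, add_sub_cancel_right] at hstep
    refine ⟨fun d hd => ?_, fun n => ?_⟩
    · rw [hstep, ih0 d hd, ih0 (d - 1) (by omega), ih0 (d - 2) (by omega)]
      simp
    · rw [prod_Icc_succ_top (b := w + 1) (by omega), hstep]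
      set P := ∏ j ∈ Icc 1 w, (C (j : ℝ) * (C α₁ + C α₂ * X) + C β * X ^ 2)
      set g := ∏ j ∈ Icc 1 (w + 1), γ j
      have h1 : g * x (n + 2 - 1) (w + 1) = (P * X).coeff n := by
        rcases n with _ | n
        · rw [ih0 _ (by simp)]
          simp
        · rw [coeff_mul_X, ← ih]
          congr 2
          push_cast
          ring
      have h2 : g * x (n + 2 - 2) (w + 1) = (P * X ^ 2).coeff n := by
        rw [coeff_mul_X_pow']
        split_ifs with h
        · rw [← ih]
          congr 2
          omega
        · rw [ih0 _ (by omega), mul_zero]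
      have hP : P * (C ((w + 1 : ℕ) : ℝ) * (C α₁ + C α₂ * X) + C β * X ^ 2) =
          C (α₁ * (w + 1)) * P + C (α₂ * (w + 1)) * (P * X) + C β * (P * X ^ 2) := by
        simp only [Nat.cast_add_one, C_mul]
        ring
      rw [prod_Icc_succ_top (by omega), hP, coeff_add, coeff_add, coeff_C_mul, coeff_C_mul, coeff_C_mul, ← h1, ← h2, ← ih]
      field_simp [hγ (w + 1 + 1)]

end Polynomial

/-- Explicit solution of the recurrence for the joint limits:
`x_{d,w} = (1/c_w) Σ_{k=1}^{w} S_{w-1}(w-k) C(w-k, d-2k) α₁^{w-d+k} α₂^{d-2k} β^{k-1}`,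
where a summand is `0` whenever the binomial coefficient `C(w-k, d-2k)` vanishes. -/
theorem stmt_3 (α₁ α₂ β : ℝ) (hα₁ : 0 < α₁) (hα₂ : 0 < α₂) (hβ : 0 < β)
    (α : ℝ) (hα : α = α₁ + α₂)
    (x : ℤ → ℕ → ℝ)
    (hbase : x 2 1 = 1 / (α + β + 1))
    (hbase' : ∀ d : ℤ, d ≠ 2 → x d 1 = 0)
    (hrec : ∀ (d : ℤ) (w : ℕ), 2 ≤ w →
      x d w = (1 / (α * w + β + 1)) *
        (α₁ * (w - 1) * x d (w - 1) + α₂ * (w - 1) * x (d - 1) (w - 1)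
          + β * x (d - 2) (w - 1)))
    (S : ℕ → ℕ → ℝ)
    (hS : ∀ n k : ℕ, S n k = ∑ s ∈ Finset.powersetCard k (Finset.Icc 1 n), ∏ i ∈ s, (i : ℝ))
    (c : ℕ → ℝ)
    (hc : ∀ w : ℕ, c w = ∏ j ∈ Finset.Icc 1 w, (α * j + β + 1)) :
    ∀ (w : ℕ), 1 ≤ w → ∀ (d : ℤ), 2 ≤ d → d ≤ 2 * (w : ℤ) →
      x d w = (1 / c w) * ∑ k ∈ Finset.Icc 1 w,
        (if 0 ≤ d - 2 * (k : ℤ) then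
          S (w - 1) (w - k) * ((w - k).choose (d - 2 * (k : ℤ)).toNat : ℝ) *
            α₁ ^ ((w : ℤ) - d + k) * α₂ ^ (d - 2 * (k : ℤ)) * β ^ (k - 1)
        else 0) := by
  intro w hw d hd _
  obtain ⟨w, rfl⟩ := Nat.exists_eq_add_of_le' hw
  obtain ⟨n, rfl⟩ : ∃ n : ℕ, d = n + 2 := ⟨(d - 2).toNat, by omega⟩
  have hα₀ : 0 < α := by rw [hα]; positivity
  have hγ (j : ℕ) : α * j + β + 1 ≠ 0 := by positivity
  have hc0 : c (w + 1) ≠ 0 := by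
    rw [hc]
    exact prod_ne_zero_iff.2 fun j _ => hγ j
  have key := (Polynomial.coeff_prod_eq_of_recurrence α₁ α₂ β (fun w => α * w + β + 1) hγ x
    (by simpa using hbase) hbase' hrec w).2 n
  rw [← hc, prod_mul_add_eq_sum_powersetCard, Nat.card_Icc, Nat.add_sub_cancel,
    Polynomial.finsetSum_coeff] at key
  rw [one_div, eq_inv_mul_iff_mul_eq₀ hc0, key]
  refine sum_nbij' (fun i => w + 1 - i) (fun k => w + 1 - k) ?_ ?_ ?_ ?_ ?_
  · intro i hi
    simp only [mem_range, mem_Icc] at hi ⊢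
    omega
  · intro k hk
    simp only [mem_range, mem_Icc] at hk ⊢
    omega
  · intro i hi
    simp only [mem_range] at hi
    omega
  · intro k hk
    simp only [mem_Icc] at hk
    omega
  intro i hi
  obtain ⟨m, rfl⟩ : ∃ m, w = i + m := Nat.exists_eq_add_of_le (by simpa [Nat.lt_succ_iff] using hi)
  have hS' : ∑ t ∈ powersetCard i (Icc 1 (i + m)), ∏ j ∈ t, Polynomial.C (j : ℝ) =
      Polynomial.C (S (i + m) i) := by
    simp [hS]
  have hX : (Polynomial.C β * Polynomial.X ^ 2) ^ m =
      Polynomial.C (β ^ m) * Polynomial.X ^ (2 * m) := by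
    rw [mul_pow, ← pow_mul, Polynomial.C_pow]
  have hk : i + m + 1 - i = m + 1 := by omega
  have hk' : i + m + 1 - (m + 1) = i := by omega
  rw [hS', Nat.add_sub_cancel_left, hX, Polynomial.coeff_C_mul, mul_left_comm,
    Polynomial.coeff_C_mul, Polynomial.coeff_mul_X_pow', hk, hk', Nat.add_sub_cancel,
    Nat.add_sub_cancel]
  by_cases h : 2 * m ≤ n
  · obtain ⟨r, rfl⟩ := Nat.exists_eq_add_of_le h
    have hr : ((2 * m + r : ℕ) : ℤ) + 2 - 2 * ((m + 1 : ℕ) : ℤ) = r := by push_cast; ring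
    rw [if_pos h, hr, if_pos (by positivity), Int.toNat_natCast, Nat.add_sub_cancel_left,
      Polynomial.coeff_C_add_C_mul_X_pow, zpow_natCast]
    rcases le_or_gt r i with hri | hri
    · have he : ((i + m + 1 : ℕ) : ℤ) - (((2 * m + r : ℕ) : ℤ) + 2) + ((m + 1 : ℕ) : ℤ) =
          ((i - r : ℕ) : ℤ) := by
        push_cast [hri]
        ring
      rw [he, zpow_natCast]
      ring
    · simp [Nat.choose_eq_zero_of_lt hri]
  · rw [if_neg h, if_neg (by push_cast; omega)]
    simp
end

section
/- For each integer d ≥ 2 the series u_d = Σ_{w=1}^∞ x_{d,w} converges (only terms with w ≥ d/2 are nonzero), and as d → ∞, u_d ∼ ( Γ(1+(β+1)/α) / (α₂·Γ(1+β/α)) ) · (α·d/α₂)^{−(1+1/α)}; equivalently, u_d·(αd/α₂)^{1+1/α} → Γ(1+(β+1)/α)/(α₂·Γ(1+β/α)). -/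
open Real Filter

namespace DegreeMarginal

open Topology Finset

/-- The solution at time `n` of the linear recursion of the joint degree-weight distribution
(with weight `n + 1`), started from `f`. -/
noncomputable def evol (α α₁ α₂ β : ℝ) (f : ℤ → ℝ) : ℕ → ℤ → ℝ
  | 0, d => f d
  | n + 1, d => (α₁ * (n + 1) * evol α α₁ α₂ β f n d + α₂ * (n + 1) * evol α α₁ α₂ β f n (d - 1)
      + β * evol α α₁ α₂ β f n (d - 2)) / (α * (n + 2) + β + 1)

/-- The marginal distribution of the weight. -/
noncomputable def mass (α β : ℝ) : ℕ → ℝ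
  | 0 => 1 / (α + β + 1)
  | n + 1 => (α * (n + 1) + β) * mass α β n / (α * (n + 2) + β + 1)

section Evolution

variable {α α₁ α₂ β : ℝ}

lemma mass_pos (hα : 0 < α) (hβ : 0 < β) (n : ℕ) : 0 < mass α β n := by
  induction n with
  | zero => simp only [mass]; positivity
  | succ n ih => simp only [mass]; positivity

lemma evol_nonneg (hα : 0 < α) (hα₁ : 0 < α₁) (hα₂ : 0 < α₂) (hβ : 0 < β) {f : ℤ → ℝ}
    (hf : ∀ d, 0 ≤ f d) (n : ℕ) (d : ℤ) : 0 ≤ evol α α₁ α₂ β f n d := by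
  induction n generalizing d with
  | zero => exact hf d
  | succ n ih =>
    have h0 := ih d
    have h1 := ih (d - 1)
    have h2 := ih (d - 2)
    simp only [evol]
    positivity

lemma evol_add_evol_eq_mass (hα : α = α₁ + α₂) {f g : ℤ → ℝ}
    (hfg : ∀ d, f d + g d = 1 / (α + β + 1)) (n : ℕ) (d : ℤ) :
    evol α α₁ α₂ β f n d + evol α α₁ α₂ β g n d = mass α β n := by
  induction n generalizing d with
  | zero => exact hfg d
  | succ n ih =>
    simp only [evol, mass]
    rw [← add_div]
    congr 1
    linear_combination α₁ * (n + 1) * ih d + α₂ * (n + 1) * ih (d - 1) + β * ih (d - 2)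
      - (n + 1) * mass α β n * hα

lemma evol_sub_one_sub {f g : ℤ → ℝ} (hfg : ∀ d, f (d - 1) - f d = g d) (n : ℕ) (d : ℤ) :
    evol α α₁ α₂ β f n (d - 1) - evol α α₁ α₂ β f n d = evol α α₁ α₂ β g n d := by
  induction n generalizing d with
  | zero => exact hfg d
  | succ n ih =>
    simp only [evol]
    rw [← sub_div]
    congr 1
    have h1 := ih (d - 1)
    have h2 := ih (d - 2)
    rw [show d - 2 - 1 = d - 1 - 2 by ring] at h2
    linear_combination α₁ * (n + 1) * ih d + α₂ * (n + 1) * h1 + β * h2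

/-- Exponential moment bound. -/
lemma exists_evol_le_pow_mul_exp (hα₁ : 0 < α₁) (hα₂ : 0 < α₂) (hβ : 0 < β)
    (hα : α = α₁ + α₂) {θ R : ℝ} (hR : (α₁ + α₂ * exp θ) / α < R) :
    ∃ C : ℝ, 0 < C ∧ ∀ f : ℤ → ℝ, (∀ d : ℤ, f d ≤ exp (-θ * (d - 2))) →
      ∀ (n : ℕ) (d : ℤ), evol α α₁ α₂ β f n d ≤ C * R ^ n * exp (-θ * d) := by
  have hα0 : 0 < α := by rw [hα]; positivity
  have hR0 : 0 < R := lt_of_le_of_lt (by positivity) hR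
  set r : ℕ → ℝ := fun n =>
    (α₁ * (n + 1) + α₂ * (n + 1) * exp θ + β * exp θ ^ 2) / (α * (n + 2) + β + 1) with hr
  have hr0 : ∀ n, 0 < r n := fun n => by simp only [hr]; positivity
  set M : ℕ → ℝ := fun n => ∏ k ∈ range n, r k with hM
  have hM0 : ∀ n, 0 < M n := fun n => prod_pos fun k _ => hr0 k
  have hMs : ∀ n, M (n + 1) = M n * r n := fun n => prod_range_succ _ _
  have hrlim : Tendsto r atTop (𝓝 ((α₁ + α₂ * exp θ) / α)) := by
    have h := (tendsto_add_mul_div_add_mul_atTop_nhds (α₁ + α₂ * exp θ + β * exp θ ^ 2)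
      (2 * α + β + 1) (α₁ + α₂ * exp θ) hα0.ne')
    refine h.congr fun n => ?_
    simp only [hr]
    congr 1 <;> ring
  have hsum : Summable fun n => M n / R ^ n := by
    refine summable_of_ratio_test_tendsto_lt_one (l := (α₁ + α₂ * exp θ) / α / R)
      ((div_lt_one hR0).2 hR) (Eventually.of_forall fun n => (div_pos (hM0 n) (by positivity)).ne')
      ((hrlim.div_const R).congr fun n => ?_)
    have h1 := hM0 n
    have h2 := hM0 (n + 1)
    rw [norm_of_nonneg (by positivity), norm_of_nonneg (by positivity), hMs]
    field_simp
    ring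
  obtain ⟨B, hB⟩ := hsum.tendsto_atTop_zero.bddAbove_range
  have hB' : ∀ n, M n ≤ B * R ^ n := fun n =>
    (div_le_iff₀ (by positivity)).1 (hB (Set.mem_range_self n))
  have hB0 : 0 < B := by simpa [hM] using (hM0 0).trans_le (hB' 0)
  refine ⟨B * exp (2 * θ), by positivity, fun f hf n d => ?_⟩
  have key : ∀ (n : ℕ) (d : ℤ), evol α α₁ α₂ β f n d ≤ M n * exp (-θ * (d - 2)) := by
    intro n
    induction n with
    | zero => intro d; simpa [hM, evol] using hf d
    | succ n ih =>
      intro d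
      have h0 := ih d
      have h1 := ih (d - 1)
      have h2 := ih (d - 2)
      have e1 : exp (-θ * (((d - 1 : ℤ) : ℝ) - 2)) = exp (-θ * (d - 2)) * exp θ := by
        rw [← Real.exp_add]; push_cast; ring_nf
      have e2 : exp (-θ * (((d - 2 : ℤ) : ℝ) - 2)) = exp (-θ * (d - 2)) * exp θ ^ 2 := by
        rw [← Real.exp_nat_mul, ← Real.exp_add]; push_cast; ring_nf
      rw [e1] at h1
      rw [e2] at h2
      rw [hMs]
      simp only [evol, hr]
      rw [mul_div_assoc', div_mul_eq_mul_div]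
      gcongr
      calc _ ≤ α₁ * (n + 1) * (M n * exp (-θ * (d - 2)))
            + α₂ * (n + 1) * (M n * (exp (-θ * (d - 2)) * exp θ))
            + β * (M n * (exp (-θ * (d - 2)) * exp θ ^ 2)) := by gcongr
        _ = _ := by ring
  calc _ ≤ M n * exp (-θ * (d - 2)) := key n d
    _ ≤ B * R ^ n * exp (-θ * (d - 2)) := by gcongr; exact hB' n
    _ = _ := by
      rw [show -θ * ((d : ℝ) - 2) = 2 * θ + -θ * d by ring, Real.exp_add]; ring

lemma exp_moment_le (hα : α = α₁ + α₂) (hα0 : 0 < α) (hα₂ : 0 < α₂) {θ : ℝ} (hθ : |θ| ≤ 1) :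
    (α₁ + α₂ * exp θ) / α ≤ exp (θ * (α₂ / α + α₂ / α * θ)) := by
  have h1 := (abs_le.1 (Real.abs_exp_sub_one_sub_id_le hθ)).2
  have h2 := Real.add_one_le_exp (θ * (α₂ / α + α₂ / α * θ))
  refine le_trans ?_ h2
  rw [div_le_iff₀ hα0]
  have : (θ * (α₂ / α + α₂ / α * θ) + 1) * α = α₂ * (θ + θ ^ 2) + α := by field_simp
  rw [this, hα]
  nlinarith

/-- Large deviations: degrees far above their typical value are exponentially unlikely. -/
lemma exists_evol_le_exp_of_le (hα₁ : 0 < α₁) (hα₂ : 0 < α₂) (hβ : 0 < β) (hα : α = α₁ + α₂)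
    {ε : ℝ} (hε : 0 < ε) :
    ∃ C η : ℝ, 0 < C ∧ 0 < η ∧ ∀ f : ℤ → ℝ, (∀ θ : ℝ, 0 ≤ θ → ∀ d : ℤ, f d ≤ exp (-θ * (d - 2))) →
      ∀ (n : ℕ) (d : ℤ), (α₂ / α + ε) * (n + 1) ≤ d →
        evol α α₁ α₂ β f n d ≤ C * exp (-η * (d + n)) := by
  have hα0 : 0 < α := by rw [hα]; positivity
  set q := α₂ / α with hq
  have hq0 : 0 < q := by positivity
  obtain ⟨θ, hθ0, hθ⟩ : ∃ θ : ℝ, 0 < θ ∧ θ < min 1 (ε / (2 * q)) :=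
    exists_between (by positivity)
  have hθ1 : θ ≤ 1 := (hθ.le.trans (min_le_left _ _))
  have hθ2 : q * θ < ε / 2 := by
    have := hθ.trans_le (min_le_right _ _)
    rw [lt_div_iff₀ (by positivity)] at this
    linarith
  have hR : (α₁ + α₂ * exp θ) / α < exp (θ * (q + ε / 2)) :=
    (exp_moment_le hα hα0 hα₂ (by rwa [abs_of_pos hθ0])).trans_lt (Real.exp_lt_exp.2 (by gcongr))
  obtain ⟨C, hC, h⟩ := exists_evol_le_pow_mul_exp hα₁ hα₂ hβ hα hR
  set κ := ε / (2 * (q + ε + 1)) with hκ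
  have hκ0 : 0 < κ := by positivity
  have hκe : κ * (q + ε + 1) = ε / 2 := by rw [hκ]; field_simp
  refine ⟨C, θ * κ, hC, by positivity, fun f hf n d hd => (h f (hf θ hθ0.le) n d).trans ?_⟩
  rw [mul_assoc, ← Real.exp_nat_mul, ← Real.exp_add]
  gcongr
  have hn : (0 : ℝ) ≤ n := n.cast_nonneg
  have h1 : 0 ≤ (1 - κ) * (d - (q + ε) * (n + 1)) := by
    refine mul_nonneg ?_ (by linarith)
    rw [hκ, sub_nonneg, div_le_one (by positivity)]
    linarith
  have h2 : κ * (d + n) ≤ d - (q + ε / 2) * n := by nlinarith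
  nlinarith [mul_le_mul_of_nonneg_left h2 hθ0.le]

/-- Large deviations: degrees far below their typical value are exponentially unlikely. -/
lemma exists_evol_le_exp_of_ge (hα₁ : 0 < α₁) (hα₂ : 0 < α₂) (hβ : 0 < β) (hα : α = α₁ + α₂)
    {ε : ℝ} (hε : 0 < ε) :
    ∃ C η : ℝ, 0 < C ∧ 0 < η ∧ ∀ f : ℤ → ℝ, (∀ θ : ℝ, 0 ≤ θ → ∀ d : ℤ, f d ≤ exp (θ * (d - 2))) →
      ∀ (n : ℕ) (d : ℤ), d ≤ (α₂ / α - ε) * (n + 1) →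
        evol α α₁ α₂ β f n d ≤ C * exp (-η * (d + n)) := by
  have hα0 : 0 < α := by rw [hα]; positivity
  set q := α₂ / α with hq
  have hq0 : 0 < q := by positivity
  obtain ⟨θ, hθ0, hθ⟩ : ∃ θ : ℝ, 0 < θ ∧ θ < min 1 (ε / (2 * q)) :=
    exists_between (by positivity)
  have hθ1 : θ ≤ 1 := (hθ.le.trans (min_le_left _ _))
  have hθ2 : q * θ < ε / 2 := by
    have := hθ.trans_le (min_le_right _ _)
    rw [lt_div_iff₀ (by positivity)] at this
    linarith
  have hR : (α₁ + α₂ * exp (-θ)) / α < exp (-θ * (q - ε / 2)) := by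
    refine (exp_moment_le hα hα0 hα₂ (by rwa [abs_neg, abs_of_pos hθ0])).trans_lt
      (Real.exp_lt_exp.2 ?_)
    rw [← hq]
    nlinarith
  obtain ⟨C, hC, h⟩ := exists_evol_le_pow_mul_exp hα₁ hα₂ hβ hα hR
  set κ := ε / (2 * (q + 1)) with hκ
  have hκ0 : 0 < κ := by positivity
  have hκe : κ * (q + 1) = ε / 2 := by rw [hκ]; field_simp
  refine ⟨C * exp (θ * (1 + κ) * q), θ * κ, by positivity, by positivity, fun f hf n d hd =>
    (h f (by simpa using hf θ hθ0.le) n d).trans ?_⟩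
  rw [mul_assoc, mul_assoc, ← Real.exp_nat_mul, ← Real.exp_add, ← Real.exp_add]
  refine mul_le_mul_of_nonneg_left (Real.exp_le_exp.2 ?_) hC.le
  have hn : (0 : ℝ) ≤ n := n.cast_nonneg
  have h1 : 0 ≤ (1 + κ) * ((q - ε) * (n + 1) - d) := mul_nonneg (by positivity) (by linarith)
  have h2 : κ * (d + n) ≤ (1 + κ) * q + (q - ε / 2) * n - d := by
    nlinarith [mul_nonneg hκ0.le hn, mul_nonneg (mul_nonneg hκ0.le hε.le) hn,
      mul_nonneg hκ0.le hε.le]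
  nlinarith [mul_le_mul_of_nonneg_left h2 hθ0.le]

end Evolution

section Series

lemma hasSum_of_telescope {y g h : ℕ → ℝ} {H : ℝ} (hy : ∀ n, 0 ≤ y n)
    (hrec : ∀ n, y n = g n - g (n + 1) + h n) (hg : Tendsto g atTop (𝓝 0)) (hH : HasSum h H) :
    HasSum y (g 0 + H) := by
  rw [hasSum_iff_tendsto_nat_of_nonneg hy]
  have h1 : Tendsto (fun n => g 0 - g n + ∑ i ∈ range n, h i) atTop (𝓝 (g 0 - 0 + H)) :=
    (hg.const_sub _).add hH.tendsto_sum_nat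
  rw [sub_zero] at h1
  refine h1.congr fun n => ?_
  rw [sum_congr rfl fun i _ => hrec i, sum_add_distrib, sum_range_sub']

variable {α β : ℝ}

lemma mass_mul_prod (hα : 0 < α) (hβ : 0 < β) (n : ℕ) :
    α * mass α β n * ∏ j ∈ range (n + 1), (1 + (β + 1) / α + (j : ℝ))
      = ∏ j ∈ range n, (1 + β / α + (j : ℝ)) := by
  induction n with
  | zero => simp [mass]; field_simp; ring
  | succ n ih =>
    rw [prod_range_succ _ (n + 1), prod_range_succ (fun j : ℕ => 1 + β / α + (j : ℝ)) n, ← ih]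
    simp only [mass]
    push_cast
    field_simp
    ring

lemma tendsto_mass_mul_rpow (hα : 0 < α) (hβ : 0 < β) :
    Tendsto (fun n : ℕ => mass α β n * (n : ℝ) ^ (1 + 1 / α)) atTop
      (𝓝 (Gamma (1 + (β + 1) / α) / (α * Gamma (1 + β / α)))) := by
  have ha : 0 < 1 + (β + 1) / α := by positivity
  have hb : 0 < 1 + β / α := by positivity
  have h1 : Tendsto (fun n : ℕ => (n : ℝ) / (1 + β / α + n)) atTop (𝓝 1) := by
    simpa using tendsto_add_mul_div_add_mul_atTop_nhds 0 (1 + β / α) (1 : ℝ) one_ne_zero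
  have h2 := ((Real.GammaSeq_tendsto_Gamma (1 + (β + 1) / α)).div
    (Real.GammaSeq_tendsto_Gamma (1 + β / α)) (Gamma_pos_of_pos hb).ne').mul (h1.const_mul α⁻¹)
  rw [show Gamma (1 + (β + 1) / α) / (α * Gamma (1 + β / α))
    = Gamma (1 + (β + 1) / α) / Gamma (1 + β / α) * (α⁻¹ * 1) by field_simp]
  refine h2.congr' ?_
  filter_upwards [eventually_gt_atTop 0] with n hn
  have hn' : (0 : ℝ) < n := Nat.cast_pos.2 hn
  have hA : 0 < ∏ j ∈ range (n + 1), (1 + (β + 1) / α + (j : ℝ)) :=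
    prod_pos fun j _ => by positivity
  have hB : 0 < ∏ j ∈ range n, (1 + β / α + (j : ℝ)) := prod_pos fun j _ => by positivity
  have hm := mass_mul_prod hα hβ n
  have hp : (n : ℝ) ^ (1 + (β + 1) / α) = (n : ℝ) ^ (1 + β / α) * (n : ℝ) ^ (1 / α) := by
    rw [← Real.rpow_add hn']; congr 1; ring
  have hf : (0 : ℝ) < n.factorial := Nat.cast_pos.2 n.factorial_pos
  have hr : 0 < (n : ℝ) ^ (1 + β / α) := Real.rpow_pos_of_pos hn' _
  have hb' : 0 < 1 + β / α + (n : ℝ) := by positivity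
  simp only [Pi.div_apply, Real.GammaSeq]
  rw [prod_range_succ (fun j : ℕ => 1 + β / α + (j : ℝ)) n, hp, Real.rpow_add hn' 1 (1 / α),
    Real.rpow_one]
  generalize (∏ j ∈ range (n + 1), (1 + (β + 1) / α + (j : ℝ))) = A at *
  generalize (∏ j ∈ range n, (1 + β / α + (j : ℝ))) = B at *
  generalize (1 + β / α + (n : ℝ)) = c at *
  subst hm
  field_simp

lemma tendsto_mul_add_mul_mass (hα : 0 < α) (hβ : 0 < β) :
    Tendsto (fun n : ℕ => (α * (n + 1) + β) * mass α β n * ((n + 1 : ℕ) : ℝ) ^ (1 / α)) atTop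
      (𝓝 (Gamma (1 + (β + 1) / α) / Gamma (1 + β / α))) := by
  have h1 : Tendsto (fun n : ℕ => (α + β + α * n) / (0 + 1 * (n : ℝ))) atTop (𝓝 (α / 1)) :=
    tendsto_add_mul_div_add_mul_atTop_nhds (α + β) 0 α one_ne_zero
  have h2 : Tendsto (fun n : ℕ => (1 + 1 * (n : ℝ)) / (0 + 1 * n)) atTop (𝓝 (1 / 1)) :=
    tendsto_add_mul_div_add_mul_atTop_nhds 1 0 (1 : ℝ) one_ne_zero
  have h3 := ((tendsto_mass_mul_rpow hα hβ).mul h1).mul (h2.rpow_const (p := 1 / α)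
    (Or.inl (by norm_num)))
  have hb : 0 < 1 + β / α := by positivity
  have hG := Gamma_pos_of_pos hb
  rw [show Gamma (1 + (β + 1) / α) / (α * Gamma (1 + β / α)) * (α / 1) * (1 / 1) ^ (1 / α)
    = Gamma (1 + (β + 1) / α) / Gamma (1 + β / α) by
      rw [div_one, div_one, Real.one_rpow]; field_simp] at h3
  refine h3.congr' ?_
  filter_upwards [eventually_gt_atTop 0] with n hn
  have hn' : (0 : ℝ) < n := Nat.cast_pos.2 hn
  have hr : 0 < (n : ℝ) ^ (1 / α) := Real.rpow_pos_of_pos hn' _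
  rw [Real.rpow_add hn', Real.rpow_one, Real.div_rpow (by positivity) (by positivity)]
  simp only [zero_add, one_mul]
  push_cast
  rw [add_comm (1 : ℝ) n]
  field_simp
  ring

lemma tendsto_mul_add_mul_mass_zero (hα : 0 < α) (hβ : 0 < β) :
    Tendsto (fun n : ℕ => (α * (n + 1) + β) * mass α β n) atTop (𝓝 0) := by
  have h1 : Tendsto (fun n : ℕ => ((n + 1 : ℕ) : ℝ) ^ (-(1 / α))) atTop (𝓝 0) :=
    (tendsto_rpow_neg_atTop (by positivity)).comp
      (tendsto_natCast_atTop_atTop.comp (tendsto_add_atTop_nat 1))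
  have h2 := (tendsto_mul_add_mul_mass hα hβ).mul h1
  rw [mul_zero] at h2
  refine h2.congr fun n => ?_
  have hr : 0 < ((n + 1 : ℕ) : ℝ) ^ (1 / α) := Real.rpow_pos_of_pos (by positivity) _
  rw [Real.rpow_neg (by positivity)]
  field_simp

lemma hasSum_mass_tail (hα : 0 < α) (hβ : 0 < β) (N : ℕ) :
    HasSum (fun n => mass α β (n + (N + 1))) ((α * (N + 1) + β) * mass α β N) := by
  have h := hasSum_of_telescope (y := fun n => mass α β (n + (N + 1)))
    (g := fun n => (α * ((n + N : ℕ) + 1) + β) * mass α β (n + N)) (h := fun _ => 0) (H := 0)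
    (fun n => (mass_pos hα hβ _).le) (fun n => ?_)
    ((tendsto_mul_add_mul_mass_zero hα hβ).comp (tendsto_add_atTop_nat N)) hasSum_zero
  · simpa using h
  · rw [show n + (N + 1) = (n + N) + 1 by ring, show n + 1 + N = (n + N) + 1 by ring]
    simp only [mass]
    push_cast
    field_simp
    ring

lemma summable_mass (hα : 0 < α) (hβ : 0 < β) : Summable (mass α β) :=
  (summable_nat_add_iff 1).1 (hasSum_mass_tail hα hβ 0).summable

lemma tendsto_tsum_mass_tail (hα : 0 < α) (hβ : 0 < β) :
    Tendsto (fun N : ℕ => (∑' n, mass α β (n + N)) * (N : ℝ) ^ (1 / α)) atTop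
      (𝓝 (Gamma (1 + (β + 1) / α) / Gamma (1 + β / α))) := by
  rw [← tendsto_add_atTop_iff_nat 1]
  refine (tendsto_mul_add_mul_mass hα hβ).congr fun N => ?_
  rw [(hasSum_mass_tail hα hβ N).tsum_eq]

end Series

section Asymptotics

lemma tendsto_mul_rpow_of_tendsto_div {Y : ℕ → ℝ} {L ρ c : ℝ} (hc : 0 < c)
    (hY : Tendsto (fun N : ℕ => Y N * (N : ℝ) ^ ρ) atTop (𝓝 L)) {N : ℕ → ℕ}
    (hN : Tendsto (fun d : ℕ => (N d : ℝ) / d) atTop (𝓝 c)) :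
    Tendsto (fun d : ℕ => Y (N d) * (d : ℝ) ^ ρ) atTop (𝓝 (L * c ^ (-ρ))) := by
  have hNtop : Tendsto N atTop atTop := by
    rw [← tendsto_natCast_atTop_iff (R := ℝ)]
    refine (hN.pos_mul_atTop hc tendsto_natCast_atTop_atTop).congr' ?_
    filter_upwards [eventually_gt_atTop 0] with d hd
    have : (0 : ℝ) < d := Nat.cast_pos.2 hd
    field_simp
  refine ((hY.comp hNtop).mul (hN.rpow_const (p := -ρ) (Or.inl hc.ne'))).congr' ?_
  filter_upwards [eventually_gt_atTop 0, hNtop.eventually_gt_atTop 0] with d hd hNd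
  have h1 : (0 : ℝ) < d := Nat.cast_pos.2 hd
  have h2 : (0 : ℝ) < N d := Nat.cast_pos.2 hNd
  have h3 := Real.rpow_pos_of_pos h1 ρ
  have h4 := Real.rpow_pos_of_pos h2 ρ
  simp only [Function.comp]
  rw [Real.rpow_neg (by positivity), Real.div_rpow h2.le h1.le]
  field_simp

lemma tendsto_exp_mul_rpow (ρ : ℝ) {η : ℝ} (hη : 0 < η) (C : ℝ) :
    Tendsto (fun d : ℕ => C * exp (-η * d) * (d : ℝ) ^ ρ) atTop (𝓝 0) := by
  have h := ((tendsto_rpow_mul_exp_neg_mul_atTop_nhds_zero ρ η hη).comp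
    tendsto_natCast_atTop_atTop).const_mul C
  rw [mul_zero] at h
  exact h.congr fun d => by simp only [Function.comp]; ring

lemma hasSum_ite_le {m : ℕ → ℝ} (hm : Summable m) (N : ℕ) :
    HasSum (fun n => if N ≤ n then m n else 0) (∑' n, m (n + N)) := by
  have h := (hasSum_nat_add_iff (f := fun n => if N ≤ n then m n else 0) (g := ∑' n, m (n + N)) N).1
    (by simpa using ((summable_nat_add_iff N).2 hm).hasSum)
  rwa [sum_eq_zero fun i hi => if_neg (not_le.2 (mem_range.1 hi)), add_zero] at h

lemma tendsto_tsum_mul_rpow {m : ℕ → ℝ} {t : ℕ → ℕ → ℝ} {L ρ q : ℝ} (hq : 0 < q)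
    (hm : Summable m)
    (hY : Tendsto (fun N : ℕ => (∑' n, m (n + N)) * (N : ℝ) ^ ρ) atTop (𝓝 L))
    (ht0 : ∀ d n, 0 ≤ t d n) (htm : ∀ d n, t d n ≤ m n)
    (hup : ∀ ε : ℝ, 0 < ε → ∃ C η : ℝ, 0 < C ∧ 0 < η ∧ ∀ d n : ℕ,
      (q + ε) * (n + 1) ≤ d → t d n ≤ C * exp (-η * (d + n)))
    (hlo : ∀ ε : ℝ, 0 < ε → ε < q → ∃ C η : ℝ, 0 < C ∧ 0 < η ∧ ∀ d n : ℕ,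
      d ≤ (q - ε) * (n + 1) → m n - t d n ≤ C * exp (-η * (d + n))) :
    Tendsto (fun d : ℕ => (∑' n, t d n) * (d : ℝ) ^ ρ) atTop (𝓝 (L * q ^ ρ)) := by
  have ht : ∀ d, Summable (t d) := fun d => hm.of_nonneg_of_le (ht0 d) (htm d)
  have hgeom : ∀ η : ℝ, 0 < η → Summable fun n : ℕ => exp (-η * n) := fun η hη => by
    simpa using Real.summable_pow_mul_exp_neg_nat_mul 0 hη
  rw [tendsto_order]
  constructor
  · intro a ha
    have hcont : Tendsto (fun ε : ℝ => L * (q - ε) ^ ρ) (𝓝[>] 0) (𝓝 (L * q ^ ρ)) := by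
      have : ContinuousAt (fun ε : ℝ => L * (q - ε) ^ ρ) 0 :=
        continuousAt_const.mul ((continuousAt_const.sub continuousAt_id).rpow_const
          (Or.inl (by simpa using hq.ne')))
      simpa using this.tendsto.mono_left nhdsWithin_le_nhds
    obtain ⟨ε, ⟨hε1, hε0⟩, hεq⟩ := ((hcont.eventually (lt_mem_nhds ha)).and
      (self_mem_nhdsWithin)).and (Ioo_mem_nhdsGT hq) |>.exists
    have hε0 : 0 < ε := hε0
    have hqε : 0 < q - ε := sub_pos.2 hεq.2
    obtain ⟨C, η, hC, hη, h⟩ := hlo ε hε0 hεq.2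
    have h1 := tendsto_mul_rpow_of_tendsto_div (inv_pos.2 hqε) hY
      ((tendsto_nat_ceil_mul_div_atTop (inv_pos.2 hqε).le).comp
        (tendsto_natCast_atTop_atTop (R := ℝ)))
    have h2 := h1.sub (tendsto_exp_mul_rpow ρ hη (C * ∑' n : ℕ, exp (-η * n)))
    rw [sub_zero, Real.inv_rpow hqε.le, Real.rpow_neg hqε.le, inv_inv] at h2
    filter_upwards [h2.eventually (lt_mem_nhds hε1)] with d hd
    refine hd.trans_le ?_
    rw [← sub_mul]
    refine mul_le_mul_of_nonneg_right ?_ (by positivity)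
    rw [sub_le_iff_le_add, ← (hasSum_ite_le hm _).tsum_eq, mul_right_comm, ← tsum_mul_left,
      ← (ht d).tsum_add ((hgeom η hη).mul_left _)]
    refine (hasSum_ite_le hm _).summable.tsum_le_tsum (fun n => ?_)
      ((ht d).add ((hgeom η hη).mul_left _))
    have he : 0 ≤ C * exp (-η * d) * exp (-η * n) := by positivity
    split_ifs with hn
    · have := h d n (by
        have h3 := Nat.ceil_le.1 hn
        rw [inv_mul_le_iff₀ hqε] at h3
        nlinarith)
      rw [mul_add, Real.exp_add, ← mul_assoc] at this
      linarith
    · linarith [ht0 d n]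
  · intro a ha
    have hcont : Tendsto (fun ε : ℝ => L * (q + ε) ^ ρ) (𝓝[>] 0) (𝓝 (L * q ^ ρ)) := by
      have : ContinuousAt (fun ε : ℝ => L * (q + ε) ^ ρ) 0 :=
        continuousAt_const.mul ((continuousAt_const.add continuousAt_id).rpow_const
          (Or.inl (by simpa using hq.ne')))
      simpa using this.tendsto.mono_left nhdsWithin_le_nhds
    obtain ⟨ε, hε1, hε0⟩ := ((hcont.eventually (gt_mem_nhds ha)).and
      (self_mem_nhdsWithin)).exists
    have hε0 : 0 < ε := hε0
    have hqε : 0 < q + ε := by positivity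
    obtain ⟨C, η, hC, hη, h⟩ := hup ε hε0
    have h1 := tendsto_mul_rpow_of_tendsto_div (inv_pos.2 hqε) hY
      ((tendsto_nat_floor_mul_div_atTop (inv_pos.2 hqε).le).comp
        (tendsto_natCast_atTop_atTop (R := ℝ)))
    have h2 := h1.add (tendsto_exp_mul_rpow ρ hη (C * ∑' n : ℕ, exp (-η * n)))
    rw [add_zero, Real.inv_rpow hqε.le, Real.rpow_neg hqε.le, inv_inv] at h2
    filter_upwards [h2.eventually (gt_mem_nhds hε1)] with d hd
    refine lt_of_le_of_lt ?_ hd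
    rw [← add_mul]
    refine mul_le_mul_of_nonneg_right ?_ (by positivity)
    rw [← (hasSum_ite_le hm _).tsum_eq, mul_right_comm, ← tsum_mul_left,
      ← (hasSum_ite_le hm _).summable.tsum_add ((hgeom η hη).mul_left _)]
    refine (ht d).tsum_le_tsum (fun n => ?_)
      ((hasSum_ite_le hm _).summable.add ((hgeom η hη).mul_left _))
    have he : 0 ≤ C * exp (-η * d) * exp (-η * n) := by positivity
    split_ifs with hn
    · linarith [htm d n]
    · have := h d n (by
        have h3 := (Nat.le_floor_iff (by positivity)).1 (Nat.succ_le_of_lt (not_le.1 hn))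
        rw [le_inv_mul_iff₀ hqε] at h3
        simpa using h3)
      rw [mul_add, Real.exp_add, ← mul_assoc] at this
      linarith

/-- If the weight concentrates around `d / q` given the degree `d`, then its first moment is
asymptotically `d / q` times the total mass. -/
lemma tendsto_first_moment_sub {x : ℕ → ℕ → ℝ} {ρ q B : ℝ} (hq : 0 < q)
    (hx0 : ∀ d n, 0 ≤ x d n) (hx : ∀ d, Summable (x d))
    (hx1 : ∀ d, Summable fun n : ℕ => ((n : ℝ) + 1) * x d n)
    (hdev : ∀ ε : ℝ, 0 < ε → ε < q → ∃ C η : ℝ, 0 < C ∧ 0 < η ∧ ∀ d n : ℕ,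
      ε * (n + 1) ≤ |q * (n + 1) - d| → x d n ≤ C * exp (-η * (d + n)))
    (hB : ∀ᶠ d : ℕ in atTop, (∑' n : ℕ, ((n : ℝ) + 1) * x d n) * (d : ℝ) ^ ρ ≤ B) :
    Tendsto (fun d : ℕ => (q * (∑' n : ℕ, ((n : ℝ) + 1) * x d n) - d * ∑' n, x d n)
      * (d : ℝ) ^ ρ) atTop (𝓝 0) := by
  rw [Metric.tendsto_nhds]
  intro δ hδ
  obtain ⟨ε, hε0, hε⟩ : ∃ ε : ℝ, 0 < ε ∧ ε < min q (δ / 2 / (|B| + 1)) :=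
    exists_between (by positivity)
  have hεq := hε.trans_le (min_le_left _ _)
  have hεB : ε * B < δ / 2 := by
    have := hε.trans_le (min_le_right _ _)
    rw [lt_div_iff₀ (by positivity)] at this
    nlinarith [le_abs_self B]
  obtain ⟨C, η, hC, hη, h⟩ := hdev ε hε0 hεq
  have hS : Summable fun n : ℕ => ((n : ℝ) + 1) * exp (-η * n) := by
    have h1 := Real.summable_pow_mul_exp_neg_nat_mul 1 hη
    have h2 := Real.summable_pow_mul_exp_neg_nat_mul 0 hη
    exact (h1.add h2).congr fun n => by ring
  set S := ∑' n : ℕ, ((n : ℝ) + 1) * exp (-η * n)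
  have hsmall : Tendsto (fun d : ℕ => (q + 1) * (d + 1) * C * exp (-η * d) * S * (d : ℝ) ^ ρ)
      atTop (𝓝 0) := by
    have h1 := (tendsto_exp_mul_rpow (1 + ρ) hη ((q + 1) * C * S)).add
      (tendsto_exp_mul_rpow ρ hη ((q + 1) * C * S))
    rw [add_zero] at h1
    refine h1.congr' ?_
    filter_upwards [eventually_gt_atTop 0] with d hd
    rw [Real.rpow_add (Nat.cast_pos.2 hd), Real.rpow_one]
    ring
  filter_upwards [hB, hsmall.eventually (gt_mem_nhds (half_pos hδ))] with d hBd hsd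
  have hd : (0 : ℝ) ≤ (d : ℝ) ^ ρ := by positivity
  rw [Real.dist_eq, sub_zero, abs_mul, abs_of_nonneg hd]
  have key : |q * (∑' n : ℕ, ((n : ℝ) + 1) * x d n) - d * ∑' n, x d n|
      ≤ ε * (∑' n : ℕ, ((n : ℝ) + 1) * x d n) + (q + 1) * (d + 1) * C * exp (-η * d) * S := by
    have hs1 := (hx1 d).mul_left ε
    have hs2 := hS.mul_left ((q + 1) * (d + 1) * C * exp (-η * d))
    rw [← tsum_mul_left, ← tsum_mul_left, ← tsum_mul_left, ← tsum_mul_left,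
      ← ((hx1 d).mul_left q).tsum_sub ((hx d).mul_left _), ← hs1.tsum_add hs2]
    rw [← Real.norm_eq_abs]
    refine tsum_of_norm_bounded (hs1.add hs2).hasSum fun n => ?_
    rw [show q * (((n : ℝ) + 1) * x d n) - d * x d n = (q * (n + 1) - d) * x d n by ring,
      Real.norm_eq_abs, abs_mul, abs_of_nonneg (hx0 d n)]
    have he : 0 ≤ (q + 1) * (d + 1) * C * exp (-η * d) * ((n + 1) * exp (-η * n)) := by positivity
    rcases le_total (|q * (n + 1) - d|) (ε * (n + 1)) with hn | hn
    · nlinarith [mul_le_mul_of_nonneg_right hn (hx0 d n)]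
    · have h1 : |q * ((n : ℝ) + 1) - d| ≤ (q + 1) * (d + 1) * (n + 1) := by
        have hdn : (0 : ℝ) ≤ d * n := by positivity
        have hd0 : (0 : ℝ) ≤ d := by positivity
        have hn0 : (0 : ℝ) ≤ n := by positivity
        rw [abs_le]
        constructor <;> nlinarith [mul_nonneg hq.le hdn, mul_nonneg hq.le hd0,
          mul_nonneg hq.le hn0]
      have h2 : 0 ≤ ε * ((n + 1) * x d n) := by have := hx0 d n; positivity
      calc _ ≤ (q + 1) * (d + 1) * (n + 1) * (C * exp (-η * (d + n))) :=
            mul_le_mul h1 (h d n hn) (hx0 d n) (by positivity)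
        _ = (q + 1) * (d + 1) * C * exp (-η * d) * ((n + 1) * exp (-η * n)) := by
            rw [mul_add (-η), Real.exp_add]; ring
        _ ≤ _ := by linarith
  calc _ ≤ (ε * (∑' n : ℕ, ((n : ℝ) + 1) * x d n) + (q + 1) * (d + 1) * C * exp (-η * d) * S)
        * (d : ℝ) ^ ρ := by gcongr
    _ = ε * ((∑' n : ℕ, ((n : ℝ) + 1) * x d n) * (d : ℝ) ^ ρ)
        + (q + 1) * (d + 1) * C * exp (-η * d) * S * (d : ℝ) ^ ρ := by ring
    _ < δ := by nlinarith [mul_le_mul_of_nonneg_left hBd hε0.le]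

/-- Passing from the tail `T` to the marginal `u` through the first moment `v`. -/
lemma tendsto_marginal_of_tail {u v T : ℕ → ℝ} {α q β ρ L : ℝ} (hα : 0 < α)
    (hT : Tendsto (fun d : ℕ => T d * (d : ℝ) ^ ρ) atTop (𝓝 L))
    (hrel : ∀ d, 1 ≤ d → T (d + 1) = α * q * v (d + 1) + β * (u (d + 1) + u d))
    (huv : Tendsto (fun d : ℕ => (q * v d - d * u d) * (d : ℝ) ^ ρ) atTop (𝓝 0))
    {B : ℝ} (hv0 : ∀ d, 0 ≤ v d) (hB : ∀ᶠ d : ℕ in atTop, v d * (d : ℝ) ^ ρ ≤ B) :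
    Tendsto (fun d : ℕ => u d * (d : ℝ) ^ (1 + ρ)) atTop (𝓝 (L / α)) := by
  have hinv : Tendsto (fun d : ℕ => ((d : ℝ))⁻¹) atTop (𝓝 0) :=
    tendsto_inv_atTop_zero.comp tendsto_natCast_atTop_atTop
  have hvinv : Tendsto (fun d : ℕ => v d * (d : ℝ) ^ ρ * (d : ℝ)⁻¹) atTop (𝓝 0) := by
    refine squeeze_zero' (Eventually.of_forall fun d => ?_) ?_ (by simpa using hinv.const_mul B)
    · have := hv0 d
      positivity
    · filter_upwards [hB] with d hd
      gcongr
  have hu0 : Tendsto (fun d : ℕ => u d * (d : ℝ) ^ ρ) atTop (𝓝 0) := by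
    have h := (hvinv.const_mul q).sub (huv.mul hinv)
    simp only [mul_zero, sub_zero] at h
    refine h.congr' ?_
    filter_upwards [eventually_gt_atTop 0] with d hd
    have : (0 : ℝ) < d := Nat.cast_pos.2 hd
    field_simp
    ring
  have hu1 : Tendsto (fun d : ℕ => u d * ((d + 1 : ℕ) : ℝ) ^ ρ) atTop (𝓝 0) := by
    have h2 : Tendsto (fun n : ℕ => (1 + 1 * (n : ℝ)) / (0 + 1 * n)) atTop (𝓝 (1 / 1)) :=
      tendsto_add_mul_div_add_mul_atTop_nhds 1 0 (1 : ℝ) one_ne_zero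
    have h := hu0.mul (h2.rpow_const (p := ρ) (Or.inl (by norm_num)))
    rw [zero_mul] at h
    refine h.congr' ?_
    filter_upwards [eventually_gt_atTop 0] with d hd
    have hd' : (0 : ℝ) < d := Nat.cast_pos.2 hd
    have := Real.rpow_pos_of_pos hd' ρ
    rw [Real.div_rpow (by positivity) (by positivity)]
    simp only [zero_add, one_mul]
    push_cast
    rw [add_comm (1 : ℝ) d]
    field_simp
  rw [← tendsto_add_atTop_iff_nat 1] at hT huv hu0 ⊢
  have h := ((hT.sub ((hu0.add hu1).const_mul β)).div_const α).sub huv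
  simp only [add_zero, mul_zero, sub_zero] at h
  refine h.congr' ?_
  filter_upwards [eventually_ge_atTop 1] with d hd
  rw [hrel d hd, Real.rpow_add (by positivity), Real.rpow_one]
  field_simp
  ring

end Asymptotics

section Marginal

variable {α α₁ α₂ β : ℝ}

lemma evol_succ_eq_telescope (hα : α = α₁ + α₂) (hα0 : 0 < α) (hβ : 0 < β) {f g : ℤ → ℝ}
    (hfg : ∀ d, g (d - 1) - g d = f d) (n : ℕ) (d : ℤ) :
    evol α α₁ α₂ β g (n + 1) d = (α * (n + 1) + β) * evol α α₁ α₂ β g n d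
      - (α * ((n + 1 : ℕ) + 1) + β) * evol α α₁ α₂ β g (n + 1) d
      + (α₂ * ((n + 1) * evol α α₁ α₂ β f n d)
        + β * (evol α α₁ α₂ β f n d + evol α α₁ α₂ β f n (d - 1))) := by
  have h1 := evol_sub_one_sub (α := α) (α₁ := α₁) (α₂ := α₂) (β := β) hfg n d
  have h2 := evol_sub_one_sub (α := α) (α₁ := α₁) (α₂ := α₂) (β := β) hfg n (d - 1)
  rw [show d - 1 - 1 = d - 2 by ring] at h2
  have h3 : (α * (n + 2) + β + 1) * evol α α₁ α₂ β g (n + 1) d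
      = α₁ * (n + 1) * evol α α₁ α₂ β g n d + α₂ * (n + 1) * evol α α₁ α₂ β g n (d - 1)
        + β * evol α α₁ α₂ β g n (d - 2) := by
    have : 0 < α * (n + 2) + β + 1 := by positivity
    simp only [evol]
    rw [mul_div_cancel₀ _ this.ne']
  push_cast
  linear_combination h3 + (α₂ * (n + 1) + β) * h1 + β * h2
    - (n + 1) * evol α α₁ α₂ β g n d * hα

lemma summable_succ_mul_evol (hα₁ : 0 < α₁) (hα₂ : 0 < α₂) (hβ : 0 < β) (hα : α = α₁ + α₂)
    {f : ℤ → ℝ} (hf0 : ∀ d, 0 ≤ f d)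
    (hf : ∀ θ : ℝ, 0 ≤ θ → ∀ d : ℤ, f d ≤ exp (θ * (d - 2))) (d : ℤ) :
    Summable fun n : ℕ => ((n : ℝ) + 1) * evol α α₁ α₂ β f n d := by
  have hα0 : 0 < α := by rw [hα]; positivity
  have hq : 0 < α₂ / α := by positivity
  obtain ⟨C, η, hC, hη, h⟩ := exists_evol_le_exp_of_ge hα₁ hα₂ hβ hα (half_pos hq)
  have hS : Summable fun n : ℕ => ((n : ℝ) + 1) * (C * exp (-η * (d + n))) := by
    have h1 := Real.summable_pow_mul_exp_neg_nat_mul 1 hη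
    have h2 := Real.summable_pow_mul_exp_neg_nat_mul 0 hη
    refine ((h1.add h2).mul_left (C * exp (-η * d))).congr fun n => ?_
    rw [mul_add (-η), Real.exp_add]
    ring
  refine Summable.of_norm_bounded_eventually_nat hS ?_
  have hlim : Tendsto (fun n : ℕ => (α₂ / α - α₂ / α / 2) * ((n : ℝ) + 1)) atTop atTop :=
    (tendsto_atTop_add_const_right _ _ tendsto_natCast_atTop_atTop).const_mul_atTop
      (by linarith)
  filter_upwards [hlim.eventually_ge_atTop (d : ℝ)] with n hn
  have h0 := evol_nonneg hα0 hα₁ hα₂ hβ hf0 n d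
  rw [norm_of_nonneg (by positivity)]
  gcongr
  exact h f hf n d hn

/-- Asymptotics of the marginal `∑' n, evol n d` for the initial condition at degree `2`. -/
lemma tendsto_tsum_evol_mul_rpow (hα₁ : 0 < α₁) (hα₂ : 0 < α₂) (hβ : 0 < β) (hα : α = α₁ + α₂)
    {f : ℤ → ℝ} (hf : f = fun d => if d = 2 then 1 / (α + β + 1) else 0) :
    (∀ d : ℤ, Summable fun n => evol α α₁ α₂ β f n d) ∧
    Tendsto (fun d : ℕ => (∑' n, evol α α₁ α₂ β f n d) * (d : ℝ) ^ (1 + 1 / α)) atTop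
      (𝓝 (Gamma (1 + (β + 1) / α) / Gamma (1 + β / α) * (α₂ / α) ^ (1 / α) / α)) := by
  have hα0 : 0 < α := by rw [hα]; positivity
  have hq : 0 < α₂ / α := by positivity
  have hc0 : 0 < 1 / (α + β + 1) := by positivity
  have hc1 : 1 / (α + β + 1) ≤ 1 := by rw [div_le_one (by positivity)]; linarith
  set c := 1 / (α + β + 1) with hc
  set g : ℤ → ℝ := fun d => if d < 2 then c else 0 with hg
  set s : ℤ → ℝ := fun d => if 2 ≤ d then c else 0 with hs
  have hf0 : ∀ d, 0 ≤ f d := fun d => by simp only [hf]; split_ifs <;> positivity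
  have hg0 : ∀ d, 0 ≤ g d := fun d => by simp only [hg]; split_ifs <;> positivity
  have hs0 : ∀ d, 0 ≤ s d := fun d => by simp only [hs]; split_ifs <;> positivity
  have hgs : ∀ d, g d + s d = c := fun d => by
    simp only [hg, hs]; split_ifs <;> first | omega | simp
  have hgf : ∀ d, g (d - 1) - g d = f d := fun d => by
    simp only [hg, hf]; split_ifs <;> first | omega | simp
  have hgu : ∀ θ : ℝ, 0 ≤ θ → ∀ d : ℤ, g d ≤ exp (-θ * (d - 2)) := fun θ hθ d => by
    simp only [hg]
    split_ifs with hd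
    · have hd' : (d : ℝ) ≤ 2 := by exact_mod_cast hd.le
      exact hc1.trans (Real.one_le_exp (by nlinarith))
    · positivity
  have hsl : ∀ θ : ℝ, 0 ≤ θ → ∀ d : ℤ, s d ≤ exp (θ * (d - 2)) := fun θ hθ d => by
    simp only [hs]
    split_ifs with hd
    · have hd' : (2 : ℝ) ≤ d := by exact_mod_cast hd
      exact hc1.trans (Real.one_le_exp (by nlinarith))
    · positivity
  have hfe : ∀ θ : ℝ, ∀ d : ℤ, f d ≤ exp (θ * (d - 2)) := fun θ d => by
    simp only [hf]
    split_ifs with hd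
    · subst hd; simpa using hc1
    · positivity
  have hx0 := fun n d => evol_nonneg hα0 hα₁ hα₂ hβ hf0 n d
  have ht0 := fun n d => evol_nonneg hα0 hα₁ hα₂ hβ hg0 n d
  have hs0' := fun n d => evol_nonneg hα0 hα₁ hα₂ hβ hs0 n d
  have hts := fun n d => evol_add_evol_eq_mass (α := α) (α₁ := α₁) (α₂ := α₂) (β := β) hα hgs n d
  have htm : ∀ n d, evol α α₁ α₂ β g n d ≤ mass α β n := fun n d => by
    linarith [hts n d, hs0' n d]
  have hx1 := fun d => summable_succ_mul_evol hα₁ hα₂ hβ hα hf0 (fun θ _ => hfe θ) d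
  have hx : ∀ d : ℤ, Summable fun n => evol α α₁ α₂ β f n d := fun d =>
    (hx1 d).of_nonneg_of_le (fun n => hx0 n d) fun n =>
      le_mul_of_one_le_left (hx0 n d) (by linarith [(n.cast_nonneg : (0 : ℝ) ≤ n)])
  refine ⟨hx, ?_⟩
  have hT : Tendsto (fun d : ℕ => (∑' n, evol α α₁ α₂ β g n d) * (d : ℝ) ^ (1 / α)) atTop
      (𝓝 (Gamma (1 + (β + 1) / α) / Gamma (1 + β / α) * (α₂ / α) ^ (1 / α))) := by
    refine tendsto_tsum_mul_rpow (t := fun d n => evol α α₁ α₂ β g n d) hq (summable_mass hα0 hβ)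
      (tendsto_tsum_mass_tail hα0 hβ) (fun d n => ht0 n d) (fun d n => htm n d)
      (fun ε hε => ?_) fun ε hε _ => ?_
    · obtain ⟨C, η, hC, hη, h⟩ := exists_evol_le_exp_of_le hα₁ hα₂ hβ hα hε
      exact ⟨C, η, hC, hη, fun d n hd => by simpa using h g hgu n d (by simpa using hd)⟩
    · obtain ⟨C, η, hC, hη, h⟩ := exists_evol_le_exp_of_ge hα₁ hα₂ hβ hα hε
      refine ⟨C, η, hC, hη, fun d n hd => ?_⟩
      rw [← hts n d, add_sub_cancel_left]
      simpa using h s hsl n d (by simpa using hd)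
  have hrel : ∀ d : ℤ, 2 ≤ d → ∑' n, evol α α₁ α₂ β g n d
      = α₂ * ∑' n : ℕ, ((n : ℝ) + 1) * evol α α₁ α₂ β f n d
        + β * (∑' n, evol α α₁ α₂ β f n d + ∑' n, evol α α₁ α₂ β f n (d - 1)) := fun d hd => by
    have hg2 : evol α α₁ α₂ β g 0 d = 0 := if_neg (not_lt.2 hd)
    have hlim : Tendsto (fun n : ℕ => (α * (n + 1) + β) * evol α α₁ α₂ β g n d) atTop (𝓝 0) :=
      squeeze_zero (fun n => by have := ht0 n d; positivity)
        (fun n => by gcongr; exact htm n d) (tendsto_mul_add_mul_mass_zero hα0 hβ)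
    have h := hasSum_of_telescope (fun n => ht0 (n + 1) d)
      (fun n => evol_succ_eq_telescope hα hα0 hβ hgf n d) hlim
      (((hx1 d).hasSum.mul_left α₂).add (((hx d).hasSum.add (hx (d - 1)).hasSum).mul_left β))
    rw [hg2, mul_zero, zero_add] at h
    have h' := (hasSum_nat_add_iff (f := fun n => evol α α₁ α₂ β g n d) 1).1 h
    rw [sum_range_one, hg2, add_zero] at h'
    exact h'.tsum_eq
  have hu0 : ∀ d : ℤ, 0 ≤ ∑' n, evol α α₁ α₂ β f n d := fun d => tsum_nonneg fun n => hx0 n d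
  have hv0 : ∀ d : ℤ, 0 ≤ ∑' n : ℕ, ((n : ℝ) + 1) * evol α α₁ α₂ β f n d := fun d =>
    tsum_nonneg fun n => mul_nonneg (by positivity) (hx0 n d)
  obtain ⟨B, hB⟩ : ∃ B : ℝ, ∀ᶠ d : ℕ in atTop,
      (∑' n : ℕ, ((n : ℝ) + 1) * evol α α₁ α₂ β f n d) * (d : ℝ) ^ (1 / α) ≤ B := by
    obtain ⟨B, hB⟩ := hT.bddAbove_range
    refine ⟨B / α₂, ?_⟩
    filter_upwards [eventually_ge_atTop 2] with d hd
    have h1 := hB (Set.mem_range_self d)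
    have h2 := hrel d (by exact_mod_cast hd)
    have h3 := mul_nonneg hβ.le (add_nonneg (hu0 d) (hu0 (d - 1)))
    rw [le_div_iff₀ hα₂]
    refine le_trans ?_ h1
    rw [mul_right_comm]
    gcongr
    rw [h2]
    linarith
  have huv := tendsto_first_moment_sub (x := fun d n => evol α α₁ α₂ β f n d) (ρ := 1 / α) hq
    (fun d n => hx0 n d) (fun d => hx d) (fun d => hx1 d) (fun ε hε _ => ?_) hB
  · refine tendsto_marginal_of_tail (u := fun d => ∑' n, evol α α₁ α₂ β f n d)
      (v := fun d => ∑' n : ℕ, ((n : ℝ) + 1) * evol α α₁ α₂ β f n d) (β := β) hα0 hT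
      (fun d hd => ?_) huv (fun d => hv0 d) hB
    have h := hrel (d + 1 : ℕ) (by omega)
    rw [h, mul_div_cancel₀ _ hα0.ne']
    simp
  · obtain ⟨C, η, hC, hη, h⟩ := exists_evol_le_exp_of_le hα₁ hα₂ hβ hα hε
    obtain ⟨C', η', hC', hη', h'⟩ := exists_evol_le_exp_of_ge hα₁ hα₂ hβ hα hε
    refine ⟨max C C', min η η', by positivity, by positivity, fun d n hd => ?_⟩
    have hdn : (0 : ℝ) ≤ d + n := by positivity
    rcases le_abs.1 hd with hd | hd
    · refine (h' f (fun θ _ => hfe θ) n d (by push_cast; linarith)).trans ?_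
      push_cast
      gcongr
      exacts [le_max_right _ _, min_le_right _ _]
    · refine (h f (fun θ _ => hfe (-θ)) n d (by push_cast; linarith)).trans ?_
      push_cast
      gcongr
      exacts [le_max_left _ _, min_le_left _ _]

end Marginal

end DegreeMarginal

/-- The degree marginal `u_d = Σ_{w≥1} x_{d,w}` exists and satisfies
`u_d ∼ (Γ(1+(β+1)/α)/(α₂ Γ(1+β/α))) (αd/α₂)^{-(1+1/α)}` as `d → ∞`. -/
theorem stmt_10 (α₁ α₂ β : ℝ) (hα₁ : 0 < α₁) (hα₂ : 0 < α₂) (hβ : 0 < β)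
    (α : ℝ) (hα : α = α₁ + α₂)
    (x2 : ℤ → ℕ → ℝ)
    (hbase : x2 2 1 = 1 / (α + β + 1))
    (hbase' : ∀ d : ℤ, d ≠ 2 → x2 d 1 = 0)
    (hrec : ∀ (d : ℤ) (w : ℕ), 2 ≤ w →
      x2 d w = (1 / (α * w + β + 1)) *
        (α₁ * (w - 1) * x2 d (w - 1) + α₂ * (w - 1) * x2 (d - 1) (w - 1)
          + β * x2 (d - 2) (w - 1))) :
    ∃ u : ℤ → ℝ,
      (∀ d : ℤ, 2 ≤ d → HasSum (fun w : ℕ => x2 d (w + 1)) (u d)) ∧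
      Tendsto (fun d : ℕ => u d * (α * d / α₂) ^ (1 + 1 / α)) atTop
        (nhds (Real.Gamma (1 + (β + 1) / α) / (α₂ * Real.Gamma (1 + β / α)))) := by
  have hα0 : 0 < α := by rw [hα]; positivity
  set f : ℤ → ℝ := fun d => if d = 2 then 1 / (α + β + 1) else 0 with hf
  have hx : ∀ (n : ℕ) (d : ℤ), x2 d (n + 1) = DegreeMarginal.evol α α₁ α₂ β f n d := by
    intro n
    induction n with
    | zero =>
      intro d
      by_cases hd : d = 2
      · subst hd
        simpa [DegreeMarginal.evol, hf] using hbase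
      · simpa [DegreeMarginal.evol, hf, hd] using hbase' d hd
    | succ n ih =>
      intro d
      have h := hrec d (n + 1 + 1) (by omega)
      rw [Nat.add_sub_cancel, ih, ih, ih] at h
      rw [h]
      simp only [DegreeMarginal.evol]
      push_cast
      rw [one_div_mul_eq_div]
      ring_nf
  obtain ⟨hsum, hlim⟩ := DegreeMarginal.tendsto_tsum_evol_mul_rpow hα₁ hα₂ hβ hα hf
  refine ⟨fun d => ∑' n, DegreeMarginal.evol α α₁ α₂ β f n d, fun d _ => ?_, ?_⟩
  · simpa only [hx] using (hsum d).hasSum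
  · have hq : 0 < α₂ / α := by positivity
    have h := hlim.mul_const (((α₂ / α) ^ (1 + 1 / α))⁻¹)
    have hr := Real.rpow_pos_of_pos hq (1 / α)
    have hG : 0 < Gamma (1 + β / α) := Gamma_pos_of_pos (by positivity)
    rw [show Gamma (1 + (β + 1) / α) / Gamma (1 + β / α) * (α₂ / α) ^ (1 / α) / α
        * ((α₂ / α) ^ (1 + 1 / α))⁻¹ = Gamma (1 + (β + 1) / α) / (α₂ * Gamma (1 + β / α)) by
      rw [Real.rpow_add hq, Real.rpow_one]
      generalize (α₂ / α) ^ (1 / α) = r at *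
      field_simp] at h
    refine h.congr fun d => ?_
    rw [mul_assoc, ← Real.inv_rpow hq.le, ← Real.mul_rpow (by positivity) (by positivity)]
    congr 2
    field_simp
end
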